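/- arXiv:1201.0778 — 5 statements merged into one kernel-verified Lean document; each statement's English description precedes it below -/
import Mathlib

section
/- There are no integers X, Y with gcd(X, Y) = 1 satisfying X² + 7⁵ · 11⁵ = Y³. -/
/-- Every positive binary quadratic form of determinant `77` takes one of the values
`1, 2, 3, 6, 7, 14`, by reduction of forms. -/
theorem exists_small_value_of_det_eq_77 (n : ℕ) : ∀ a b c : ℤ, a.toNat = n → 0 < a →
    a * c - b ^ 2 = 77 → ∃ u v : ℤ, a * u ^ 2 + 2 * b * u * v + c * v ^ 2 ∈
      ({1, 2, 3, 6, 7, 14} : Finset ℤ) := by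
  induction n using Nat.strong_induction_on with
  | _ n ih =>
    intro a b c hn ha hdet
    obtain ⟨k, d, rfl, hd₁, hd₂⟩ : ∃ k d : ℤ, b = d + k * a ∧ -a ≤ 2 * d ∧ 2 * d ≤ a := by
      have h₁ := Int.mul_ediv_add_emod (2 * b + a) (2 * a)
      have h₂ := Int.emod_nonneg (2 * b + a) (show 2 * a ≠ 0 by omega)
      have h₃ := Int.emod_lt_of_pos (2 * b + a) (show 0 < 2 * a by omega)
      refine ⟨(2 * b + a) / (2 * a), b - (2 * b + a) / (2 * a) * a, by ring, ?_, ?_⟩ <;>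
        linarith
    obtain ⟨e, rfl⟩ : ∃ e : ℤ, c = e + 2 * d * k + k ^ 2 * a :=
      ⟨c - 2 * d * k - k ^ 2 * a, by ring⟩
    have hdet' : a * e = 77 + d ^ 2 := by linarith
    suffices h : ∃ u v : ℤ, a * u ^ 2 + 2 * d * u * v + e * v ^ 2 ∈
        ({1, 2, 3, 6, 7, 14} : Finset ℤ) by
      obtain ⟨u, v, h⟩ := h
      refine ⟨u - k * v, v, ?_⟩
      convert h using 1
      ring
    have he : 0 < e := by
      by_contra! he
      nlinarith [sq_nonneg d]
    by_cases hea : e < a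
    · obtain ⟨u, v, h⟩ := ih e.toNat (by omega) e d a rfl he (by linarith)
      refine ⟨v, u, ?_⟩
      convert h using 1
      ring
    · have ha' : a ≤ 10 := by nlinarith
      by_cases h₉ : a = 9 ∧ (d = 2 ∨ d = -2)
      · obtain ⟨rfl, rfl | rfl⟩ := h₉
        · obtain rfl : e = 9 := by omega
          exact ⟨1, -1, by decide⟩
        · obtain rfl : e = 9 := by omega
          exact ⟨1, 1, by decide⟩
      · refine ⟨1, 0, ?_⟩
        have hd₃ : -5 ≤ d := by omega
        have hd₄ : d ≤ 5 := by omega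
        simp only [Finset.mem_insert, Finset.mem_singleton]
        interval_cases d <;> interval_cases a <;> omega

theorem eq_one_of_cube_eq_sq_add {m s t : ℤ} (hm : m ∈ ({1, 2, 3, 6, 7, 14} : Finset ℤ))
    (h : s ^ 2 + 77 * t ^ 2 = m ^ 3) : m = 1 ∧ (s = 1 ∨ s = -1) ∧ t = 0 := by
  obtain ⟨n, hn, rfl⟩ : ∃ n ∈ ({1, 2, 3, 6, 7, 14} : Finset ℕ), m = n := by
    simp only [Finset.mem_insert, Finset.mem_singleton] at hm
    rcases hm with rfl | rfl | rfl | rfl | rfl | rfl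
    exacts [⟨1, by decide, rfl⟩, ⟨2, by decide, rfl⟩, ⟨3, by decide, rfl⟩, ⟨6, by decide, rfl⟩,
      ⟨7, by decide, rfl⟩, ⟨14, by decide, rfl⟩]
  have hnat : s.natAbs ^ 2 + 77 * t.natAbs ^ 2 = n ^ 3 := by
    zify
    simpa only [sq_abs] using h
  have hn' : n ^ 3 ≤ 2744 :=
    (by decide : ∀ n ∈ ({1, 2, 3, 6, 7, 14} : Finset ℕ), n ^ 3 ≤ 2744) n hn
  have hs : s.natAbs < 53 := by nlinarith
  have ht : t.natAbs < 6 := by nlinarith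
  have key : ∀ n ∈ ({1, 2, 3, 6, 7, 14} : Finset ℕ), ∀ t < 6, ∀ s < 53,
      s ^ 2 + 77 * t ^ 2 = n ^ 3 → n = 1 ∧ s = 1 ∧ t = 0 := by
    decide +kernel
  obtain ⟨h₁, h₂, h₃⟩ := key n hn _ ht _ hs hnat
  exact ⟨by simp [h₁], Int.natAbs_eq_natAbs_iff.1 (h₂.trans Int.natAbs_one.symm),
    Int.natAbs_eq_zero.1 h₃⟩

/-- If `X + Z√-77` has norm `Y³` and `Z` is prime to `Y`, then `X + Z√-77` is a cube in `ℤ[√-77]`,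
reflecting that the class number of `ℚ(√-77)` is prime to `3`. -/
theorem exists_cube_of_sq_add_77_mul_sq {X Y Z : ℤ} (hY : 0 < Y) (hZ : IsCoprime Z Y)
    (h : X ^ 2 + 77 * Z ^ 2 = Y ^ 3) :
    ∃ x y : ℤ, X = x ^ 3 - 231 * x * y ^ 2 ∧ Z = 3 * x ^ 2 * y - 77 * y ^ 3 ∧
      Y = x ^ 2 + 77 * y ^ 2 := by
  obtain ⟨p, q, hpq⟩ : IsCoprime Z (Y ^ 3) := hZ.pow_right
  -- `r` is `X / Z` modulo `Y ^ 3`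
  obtain ⟨r, g, hr⟩ : ∃ r g : ℤ, X = r * Z + g * Y ^ 3 :=
    ⟨X * p, X * q, by linear_combination (-X) * hpq⟩
  obtain ⟨w, hw⟩ : Y ^ 3 ∣ r ^ 2 + 77 := by
    have hc : IsCoprime (Y ^ 3) (Z ^ 2) := (hZ.pow (m := 2) (n := 3)).symm
    refine hc.dvd_of_dvd_mul_left ⟨1 - 2 * r * Z * g - g ^ 2 * Y ^ 3, ?_⟩
    rw [hr] at h
    linear_combination h
  -- the form `N(Y * u + (r + √-77) * v) / Y` has determinant `77`
  obtain ⟨u, v, hm⟩ := exists_small_value_of_det_eq_77 _ Y r (Y ^ 2 * w) rfl hY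
    (by linear_combination -hw)
  generalize hmdef : Y * u ^ 2 + 2 * r * u * v + Y ^ 2 * w * v ^ 2 = m at hm
  obtain ⟨x, hx⟩ : ∃ x, x = Y * u + r * v := ⟨_, rfl⟩
  have hnorm : x ^ 2 + 77 * v ^ 2 = Y * m := by
    rw [hx, ← hmdef]; linear_combination v ^ 2 * hw
  obtain ⟨e, he⟩ : Y ^ 3 ∣ (x ^ 3 - 231 * x * v ^ 2) - r * (3 * x ^ 2 * v - 77 * v ^ 3) := by
    refine ⟨u ^ 3 - 3 * w * x * v ^ 2 + r * w * v ^ 3, ?_⟩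
    rw [hx]
    linear_combination (-3 * (Y * u + r * v) * v ^ 2 + r * v ^ 3) * hw
  -- `s + t * √-77` is `(x + v√-77) ^ 3 / (X + Z√-77)`
  obtain ⟨s, hs⟩ : Y ^ 3 ∣
      (x ^ 3 - 231 * x * v ^ 2) * X + 77 * (3 * x ^ 2 * v - 77 * v ^ 3) * Z := by
    refine ⟨(x ^ 3 - 231 * x * v ^ 2) * g +
      Z * (r * e + w * (3 * x ^ 2 * v - 77 * v ^ 3)), ?_⟩
    rw [hr]
    linear_combination Z * r * he + Z * (3 * x ^ 2 * v - 77 * v ^ 3) * hw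
  obtain ⟨t, ht⟩ : Y ^ 3 ∣ (3 * x ^ 2 * v - 77 * v ^ 3) * X - (x ^ 3 - 231 * x * v ^ 2) * Z := by
    refine ⟨(3 * x ^ 2 * v - 77 * v ^ 3) * g - Z * e, ?_⟩
    rw [hr]
    linear_combination -Z * he
  have hst : s ^ 2 + 77 * t ^ 2 = m ^ 3 := by
    refine mul_left_cancel₀ (pow_ne_zero 6 hY.ne') ?_
    calc Y ^ 6 * (s ^ 2 + 77 * t ^ 2) = (Y ^ 3 * s) ^ 2 + 77 * (Y ^ 3 * t) ^ 2 := by ring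
      _ = (x ^ 2 + 77 * v ^ 2) ^ 3 * (X ^ 2 + 77 * Z ^ 2) := by rw [← hs, ← ht]; ring
      _ = Y ^ 6 * m ^ 3 := by rw [hnorm, h]; ring
  obtain ⟨rfl, hs1, rfl⟩ := eq_one_of_cube_eq_sq_add hm hst
  have hA : x ^ 3 - 231 * x * v ^ 2 = s * X := by
    refine mul_left_cancel₀ (pow_ne_zero 3 hY.ne') ?_
    linear_combination X * hs - 77 * Z * ht - (x ^ 3 - 231 * x * v ^ 2) * h
  have hB : 3 * x ^ 2 * v - 77 * v ^ 3 = s * Z := by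
    refine mul_left_cancel₀ (pow_ne_zero 3 hY.ne') ?_
    linear_combination Z * hs + X * ht - (3 * x ^ 2 * v - 77 * v ^ 3) * h
  rcases hs1 with rfl | rfl
  · exact ⟨x, v, by linarith, by linarith, by linarith⟩
  · exact ⟨-x, -v, by linear_combination hA, by linear_combination hB,
      by linear_combination -hnorm⟩

theorem not_dvd_three_mul_sq_sub_of_gcd_eq_one {p x y : ℤ} (hp : Prime p) (hp77 : p ∣ 77)
    (hp3 : ¬ p ∣ 3)
    (h : Int.gcd (x ^ 3 - 231 * x * y ^ 2) (x ^ 2 + 77 * y ^ 2) = 1) :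
    ¬ p ∣ 3 * x ^ 2 - 77 * y ^ 2 := by
  intro hc
  have h₁ : p ∣ 3 * x ^ 2 := (dvd_sub_left (hp77.mul_right _)).1 hc
  have hpx : p ∣ x := hp.dvd_of_dvd_pow ((hp.dvd_or_dvd h₁).resolve_left hp3)
  refine hp.not_isUnit (isUnit_of_dvd_one ?_)
  have h₂ := Int.dvd_coe_gcd
    (dvd_sub (dvd_pow hpx three_ne_zero) ((hpx.mul_left 231).mul_right (y ^ 2)))
    (dvd_add (dvd_pow hpx two_ne_zero) (hp77.mul_right (y ^ 2)))
  rwa [h, Nat.cast_one] at h₂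

theorem stmt_11 : ¬ ∃ X Y : ℤ, Int.gcd X Y = 1 ∧ X ^ 2 + 7 ^ 5 * 11 ^ 5 = Y ^ 3 := by
  rintro ⟨X, Y, hgcd, h⟩
  have hY : 0 < Y := by
    rw [← Odd.pow_pos_iff (n := 3) (by decide), ← h]
    positivity
  have hp7 : Prime (7 : ℤ) := by norm_num
  have hp11 : Prime (11 : ℤ) := by norm_num
  have hcop : ∀ p : ℤ, Prime p → p ∣ 77 → IsCoprime p Y := by
    intro p hp hp77
    rw [hp.coprime_iff_not_dvd]
    intro hpY
    have hpX : p ∣ X := by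
      refine hp.dvd_of_dvd_pow (n := 2) ?_
      rw [show X ^ 2 = Y ^ 3 - 77 * 77 ^ 4 by linear_combination h]
      exact dvd_sub (dvd_pow hpY three_ne_zero) (hp77.mul_right _)
    have hdvd := Int.dvd_coe_gcd hpX hpY
    rw [hgcd, Nat.cast_one] at hdvd
    exact hp.not_isUnit (isUnit_of_dvd_one hdvd)
  have hZ : IsCoprime (77 ^ 2 : ℤ) Y := by
    have := ((hcop 7 hp7 (by norm_num)).mul_left (hcop 11 hp11 (by norm_num))).pow_left (m := 2)
    norm_num at this ⊢
    exact this
  obtain ⟨x, y, rfl, hy, rfl⟩ :=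
    exists_cube_of_sq_add_77_mul_sq hY hZ (X := X) (by linear_combination h)
  have h7 := not_dvd_three_mul_sq_sub_of_gcd_eq_one hp7 (by norm_num) (by norm_num) hgcd
  have h11 := not_dvd_three_mul_sq_sub_of_gcd_eq_one hp11 (by norm_num) (by norm_num) hgcd
  have hunit : IsUnit (3 * x ^ 2 - 77 * y ^ 2) := by
    have hc : IsCoprime (3 * x ^ 2 - 77 * y ^ 2) ((7 * 11) ^ 2) :=
      (((hp7.coprime_iff_not_dvd.2 h7).mul_left (hp11.coprime_iff_not_dvd.2 h11)).pow_left).symm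
    exact hc.isUnit_of_dvd' dvd_rfl ⟨y, by linear_combination hy⟩
  rcases Int.isUnit_iff.1 hunit with h₁ | h₁
  · -- `3 * x ^ 2 ≡ 1` has no solution modulo `7`
    have h₂ : (3 * x ^ 2) % 7 = 1 := by omega
    have h₃ := Int.emod_nonneg x (show (7 : ℤ) ≠ 0 by norm_num)
    have h₄ := Int.emod_lt_of_pos x (show (0 : ℤ) < 7 by norm_num)
    rw [Int.mul_emod, pow_two, Int.mul_emod x x] at h₂
    interval_cases x % 7 <;> omega
  · have hy' : y = -77 ^ 2 := by linear_combination y * h₁ + hy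
    norm_num [hy'] at h₁
    omega
end

section
/- There are no integers u, v with gcd(u, v) = 1 satisfying 7² · 11² = v · (3u²v − 77v²). -/
theorem stmt_13 : ¬ ∃ u v : ℤ, Int.gcd u v = 1 ∧
    7 ^ 2 * 11 ^ 2 = v * (3 * u ^ 2 * v - 77 * v ^ 2) := by
  rintro ⟨u, v, -, h⟩
  have hsq : v ^ 2 ∣ 77 ^ 2 := ⟨3 * u ^ 2 - 77 * v, by linear_combination h⟩
  have hv : v ∣ 77 := (Int.pow_dvd_pow_iff two_ne_zero).mp hsq
  have hv_le : v ≤ 77 := Int.le_of_dvd (by norm_num) hv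
  have hv_ge : -77 ≤ v := by
    linarith [Int.le_of_dvd (by norm_num) (neg_dvd.mpr hv)]
  have hu_le : u ≤ 45 := by
    by_contra! hu
    interval_cases v <;> first | omega | nlinarith
  have hu_ge : -45 ≤ u := by
    by_contra! hu
    interval_cases v <;> first | omega | nlinarith
  interval_cases v <;> first | omega | (interval_cases u <;> omega)
end

section
/- Let n ≥ 3 and let x, y, α, β be nonnegative integers satisfying x² + 7^α · 11^β = yⁿ. If x is odd, then α is odd and β is even. -/
theorem stmt_14 (n x y α β : ℕ) (hn : 3 ≤ n)
    (h : x ^ 2 + 7 ^ α * 11 ^ β = y ^ n) (hx : Odd x) :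
    Odd α ∧ Even β := by
  have hy : Even y := by
    have hodd : Odd (7 ^ α * 11 ^ β) :=
      (Odd.pow (by decide)).mul (Odd.pow (by decide))
    have hpow : Even (y ^ n) := h ▸ hx.pow.add_odd hodd
    exact (Nat.even_pow.mp hpow).1
  have hdvd : 8 ∣ y ^ n :=
    (pow_dvd_pow_of_dvd hy.two_dvd 3).trans (pow_dvd_pow y hn)
  have hsq : x ^ 2 % 8 = 1 := by
    have hsub := Nat.eight_dvd_sq_sub_one_of_odd hx
    have hpos : 0 < x ^ 2 := pow_pos hx.pos 2
    omega
  have hmod : 7 ^ α * 11 ^ β % 8 = 7 := by omega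
  have h7 (k : ℕ) : 7 ^ (k + k) % 8 = 1 := by
    rw [← two_mul, pow_mul, Nat.pow_mod]; simp
  have h11 (k : ℕ) : 11 ^ (k + k) % 8 = 1 := by
    rw [← two_mul, pow_mul, Nat.pow_mod]; simp
  rcases Nat.even_or_odd β with hβ | ⟨b, rfl⟩
  · refine ⟨?_, hβ⟩
    by_contra hα
    obtain ⟨a, rfl⟩ := Nat.not_odd_iff_even.mp hα
    obtain ⟨b, rfl⟩ := hβ
    simp [Nat.mul_mod, h7, h11] at hmod
  · exfalso
    rw [two_mul] at hmod
    rcases Nat.even_or_odd α with ⟨a, rfl⟩ | ⟨a, rfl⟩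
    · simp [pow_succ, Nat.mul_mod, h7, h11] at hmod
    · rw [two_mul] at hmod
      simp [pow_succ, Nat.mul_mod, h7, h11] at hmod
end

section
/- Let U and V be rational numbers whose denominators are powers of 7 (i.e., {7}-integral rationals) satisfying 11·V² = 5·U⁴ − 70·U² + 49. Then (U, V) ∈ {(7, 28), (7, −28), (−7, 28), (−7, −28)}. -/
open NumberTheorySymbols

/-- The fundamental unit `89 + 12√55` of `ℤ[√55]`. -/
def pellUnit : ℤ√55 := ⟨89, 12⟩

lemma pellUnit_pow_succ_re (n : ℕ) :
    (pellUnit ^ (n + 1)).re = 89 * (pellUnit ^ n).re + 660 * (pellUnit ^ n).im := by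
  rw [pow_succ', Zsqrtd.re_mul]
  simp only [pellUnit]
  ring

lemma pellUnit_pow_succ_im (n : ℕ) :
    (pellUnit ^ (n + 1)).im = 12 * (pellUnit ^ n).re + 89 * (pellUnit ^ n).im := by
  rw [pow_succ', Zsqrtd.im_mul]
  simp only [pellUnit]
  ring

lemma pellUnit_pow_norm (n : ℕ) :
    (pellUnit ^ n).re ^ 2 - 55 * (pellUnit ^ n).im ^ 2 = 1 := by
  induction n with
  | zero => simp
  | succ n ih =>
    rw [pellUnit_pow_succ_re, pellUnit_pow_succ_im]
    linear_combination ih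

lemma exists_nat_pellUnit_pow (n : ℕ) :
    ∃ c s : ℕ, 0 < c ∧ (pellUnit ^ n).re = c ∧ (pellUnit ^ n).im = s := by
  induction n with
  | zero => exact ⟨1, 0, by simp⟩
  | succ n ih =>
    obtain ⟨c, s, hc, h1, h2⟩ := ih
    refine ⟨89 * c + 660 * s, 12 * c + 89 * s, by positivity, ?_, ?_⟩
    · rw [pellUnit_pow_succ_re, h1, h2]; push_cast; ring
    · rw [pellUnit_pow_succ_im, h1, h2]; push_cast; ring

lemma dvd_pow_add_sub_pow {R : Type*} [CommRing R] {d x : R} {p : ℕ} (h : d ∣ x ^ p - 1)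
    (q i : ℕ) : d ∣ x ^ (p * q + i) - x ^ i := by
  have : x ^ (p * q + i) - x ^ i = ((x ^ p) ^ q - 1 ^ q) * x ^ i := by
    rw [pow_add, pow_mul]; ring
  rw [this]
  exact (h.trans (sub_dvd_pow_sub_pow _ _ q)).mul_right _

/-- Every positive solution of `5x² - 11y² = 1` comes from `(3√5 + 2√11)(89 + 12√55)ⁿ`. -/
lemma exists_eq_pellUnit_pow (y x : ℕ) (h : 5 * x ^ 2 = 11 * y ^ 2 + 1) :
    ∃ n : ℕ, (x : ℤ) = 3 * (pellUnit ^ n).re + 22 * (pellUnit ^ n).im ∧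
      (y : ℤ) = 2 * (pellUnit ^ n).re + 15 * (pellUnit ^ n).im := by
  induction y using Nat.strong_induction_on generalizing x with
  | _ y ih =>
    rcases lt_or_ge y 27 with hy | hy
    · have hx : x < 41 := by nlinarith
      have key : ∀ y < 27, ∀ x < 41, 5 * x ^ 2 = 11 * y ^ 2 + 1 → x = 3 ∧ y = 2 := by
        decide +kernel
      obtain ⟨rfl, rfl⟩ := key y hy x hx h
      exact ⟨0, by simp⟩
    · have h1 : 60 * x ≤ 89 * y := by
        by_contra! hc
        nlinarith
      have h2 : 132 * y ≤ 89 * x := by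
        by_contra! hc
        nlinarith
      have h3 : 89 * y - 60 * x < y := by
        have : 88 * y < 60 * x := by
          by_contra! hc
          nlinarith
        omega
      obtain ⟨n, hn1, hn2⟩ := ih (89 * y - 60 * x) h3 (89 * x - 132 * y) (by
        zify [h1, h2]
        zify at h
        linear_combination h)
      push_cast [h1, h2] at hn1 hn2
      refine ⟨n + 1, ?_, ?_⟩
      · rw [pellUnit_pow_succ_re, pellUnit_pow_succ_im]
        linear_combination 89 * hn1 + 132 * hn2
      · rw [pellUnit_pow_succ_re, pellUnit_pow_succ_im]
        linear_combination 60 * hn1 + 89 * hn2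

lemma pow_half_ne_of_sq {p : ℕ} (hp : p.Prime) (hp2 : p ≠ 2) (z : ℤ) :
    (z ^ 2 % p).toNat ^ (p / 2) % p ≠ p - 1 := by
  intro h
  have := Fact.mk hp
  have hlt : 2 < p := by have := hp.two_le; omega
  have h0 : 0 ≤ z ^ 2 % (p : ℤ) := Int.emod_nonneg _ (by exact_mod_cast hp.ne_zero)
  have h1 : (((z ^ 2 % p).toNat ^ (p / 2) : ℕ) : ZMod p) = -1 := by
    rw [← ZMod.natCast_mod, h, Nat.cast_sub hp.one_le]
    simp
  have h2 : (((z ^ 2 % p).toNat : ℕ) : ZMod p) = (z : ZMod p) ^ 2 := by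
    rw [← Int.cast_natCast, Int.toNat_of_nonneg h0]
    simp
  rw [Nat.cast_pow, h2, ← pow_mul] at h1
  have hodd : 2 * (p / 2) = p - 1 := by
    have := hp.eq_two_or_odd
    omega
  rw [hodd] at h1
  have hne : (1 : ZMod p) ≠ -1 := by
    have := Fact.mk hlt
    exact (ZMod.neg_one_ne_one).symm
  by_cases hz : (z : ZMod p) = 0
  · rw [hz, zero_pow (by omega)] at h1
    simp at h1
  · rw [ZMod.pow_card_sub_one_eq_one hz] at h1
    exact hne h1

lemma exponent_mod {n : ℕ} {u : ℤ}
    (h : 7 * u ^ 2 = 2 * (3 * (pellUnit ^ n).re + 22 * (pellUnit ^ n).im) + 1) :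
    n % 117 = 0 ∨ n % 117 = 116 := by
  have key : ∀ r < 117, r = 0 ∨ r = 116 ∨ ∃ p ∈ [19, 79, 179, 701, 1871],
      ((7 * (2 * (3 * (pellUnit ^ r).re + 22 * (pellUnit ^ r).im) + 1)) % (p : ℕ)).toNat ^ (p / 2)
        % p = p - 1 := by decide +kernel
  rcases key (n % 117) (Nat.mod_lt _ (by norm_num)) with h0 | h0 | ⟨p, hp, hr⟩
  · exact .inl h0
  · exact .inr h0
  exfalso
  have hdvd : ∀ p ∈ [19, 79, 179, 701, 1871],
      ((p : ℕ) : ℤ) ∣ (pellUnit ^ 117 - 1).re ∧ ((p : ℕ) : ℤ) ∣ (pellUnit ^ 117 - 1).im := by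
    decide +kernel
  have hpp : p.Prime ∧ p ≠ 2 := by
    simp only [List.mem_cons, List.not_mem_nil, or_false] at hp
    rcases hp with rfl | rfl | rfl | rfl | rfl <;> norm_num
  have hd := dvd_pow_add_sub_pow ((Zsqrtd.intCast_dvd _ _).2 (hdvd p hp)) (n / 117) (n % 117)
  rw [Nat.div_add_mod, Zsqrtd.intCast_dvd, Zsqrtd.re_sub, Zsqrtd.im_sub] at hd
  have e : (7 * u) ^ 2 % (p : ℤ) = (7 * (2 * (3 * (pellUnit ^ (n % 117)).re
      + 22 * (pellUnit ^ (n % 117)).im) + 1)) % p := by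
    refine Int.modEq_iff_dvd.2 ?_
    have hsplit : 7 * (2 * (3 * (pellUnit ^ (n % 117)).re + 22 * (pellUnit ^ (n % 117)).im) + 1)
        - (7 * u) ^ 2 = -42 * ((pellUnit ^ n).re - (pellUnit ^ (n % 117)).re)
          + -308 * ((pellUnit ^ n).im - (pellUnit ^ (n % 117)).im) := by
      linear_combination (-7 : ℤ) * h
    rw [hsplit]
    exact dvd_add (hd.1.mul_left _) (hd.2.mul_left _)
  rw [← e] at hr
  exact pow_half_ne_of_sq hpp.1 hpp.2 _ hr

lemma jacobiSym_eq_jacobiSym_neg {a b : ℕ} (ha : Odd a) (hb : b % 4 = 3) :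
    J(a | b) = J(-b | a) := by
  rw [jacobiSym.neg _ ha]
  rcases Nat.odd_mod_four_iff.1 (Nat.odd_iff.1 ha) with h | h
  · rw [jacobiSym.quadratic_reciprocity_one_mod_four h (Nat.odd_iff.2 (by omega)),
      ZMod.χ₄_nat_one_mod_four h, one_mul]
  · rw [jacobiSym.quadratic_reciprocity_three_mod_four h hb, ZMod.χ₄_nat_three_mod_four h]
    ring

lemma jacobiSym_left_factor {X Y M : ℕ} (hX : Odd X) (hM : M % 4 = 3)
    (h : 5 * X ^ 2 = 11 * Y ^ 2 + 1) (hMeq : M = 15 * X ^ 2 + 11 * Y ^ 2) :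
    J(X | M) = J(-11 | X % 44) := by
  rw [jacobiSym_eq_jacobiSym_neg hX hM]
  have hco : IsCoprime (Y : ℤ) X := ⟨-11 * Y, 5 * X, by
    zify at h; linear_combination h⟩
  have h1 : J(-M | X) = J(-11 * (Y : ℤ) ^ 2 | X) := by
    apply jacobiSym.mod_left'
    apply (Int.modEq_iff_dvd.2 _)
    exact ⟨15 * X, by rw [hMeq]; push_cast; ring⟩
  rw [h1, jacobiSym.mul_left, jacobiSym.sq_one' (Int.isCoprime_iff_gcd_eq_one.1 hco), mul_one,
    jacobiSym.mod_right _ hX]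
  rfl

lemma jacobiSym_right_factor {X Y M D : ℕ} {ρ : ℤ} (hρ : ρ ^ 2 = 1) (hD : Odd D)
    (hM : M % 4 = 3) (h : 5 * X ^ 2 = 11 * Y ^ 2 + 1) (hMeq : M = 15 * X ^ 2 + 11 * Y ^ 2)
    (hDeq : (D : ℤ) = 11 * Y - 5 * ρ * X) :
    J(D | M) = J(-2090 | D % 8360) := by
  rw [jacobiSym_eq_jacobiSym_neg hD hM]
  zify at h
  have hco : IsCoprime (Y : ℤ) D := ⟨11 * ρ * X - 11 * Y, -(ρ * X), by
    rw [hDeq]; linear_combination h + 5 * X ^ 2 * hρ⟩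
  have hco5 : IsCoprime (5 : ℤ) D := ⟨X ^ 2 - ρ * X * Y, -Y, by
    rw [hDeq]; linear_combination h⟩
  have h1 : J(-M * 5 ^ 2 | D) = J(-2090 * (Y : ℤ) ^ 2 | D) := by
    apply jacobiSym.mod_left'
    apply (Int.modEq_iff_dvd.2 _)
    refine ⟨-15 * (11 * Y + 5 * ρ * X), ?_⟩
    rw [hDeq, hMeq]; push_cast
    linear_combination (-375 : ℤ) * X ^ 2 * hρ
  rw [jacobiSym.mul_left, jacobiSym.mul_left,
    jacobiSym.sq_one' (Int.isCoprime_iff_gcd_eq_one.1 hco),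
    jacobiSym.sq_one' (Int.isCoprime_iff_gcd_eq_one.1 hco5), mul_one, mul_one] at h1
  rw [h1, jacobiSym.mod_right _ hD]
  rfl

lemma pellUnit_pow_residues (w : ℕ) {c s : ℕ} (hc : (pellUnit ^ (9 * w + 4)).re = c)
    (hs : (pellUnit ^ (9 * w + 4)).im = s) :
    (w % 8, (c : ℤ) % 58520, (s : ℤ) % 1064) ∈
      ([(0, 7041, 224), (1, 13729, 604), (2, 40481, 832), (3, 55529, 604),
      (4, 15401, 224), (5, 55529, 908), (6, 40481, 680), (7, 13729, 908)] : List (ℕ × ℤ × ℤ)) := by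
  have hp : (⟨0, 1064⟩ : ℤ√55) ∣ pellUnit ^ 72 - 1 :=
    Dvd.intro ⟨(pellUnit ^ 72 - 1).im / 1064, (pellUnit ^ 72 - 1).re / 58520⟩
      (by decide +kernel)
  obtain ⟨z, hz⟩ := dvd_pow_add_sub_pow hp (w / 8) (9 * (w % 8) + 4)
  have hw : 72 * (w / 8) + (9 * (w % 8) + 4) = 9 * w + 4 := by omega
  rw [hw] at hz
  have hre := congrArg Zsqrtd.re hz
  have him := congrArg Zsqrtd.im hz
  simp only [Zsqrtd.re_sub, Zsqrtd.im_sub, Zsqrtd.re_mul, Zsqrtd.im_mul, hc, hs] at hre him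
  have hval : ∀ i < 8,
      (i, (pellUnit ^ (9 * i + 4)).re % 58520, (pellUnit ^ (9 * i + 4)).im % 1064) ∈
      ([(0, 7041, 224), (1, 13729, 604), (2, 40481, 832), (3, 55529, 604),
      (4, 15401, 224), (5, 55529, 908), (6, 40481, 680), (7, 13729, 908)] : List (ℕ × ℤ × ℤ)) := by
    decide +kernel
  rw [show (c : ℤ) % 58520 = (pellUnit ^ (9 * (w % 8) + 4)).re % 58520 by clear hval; omega,
    show (s : ℤ) % 1064 = (pellUnit ^ (9 * (w % 8) + 4)).im % 1064 by clear hval; omega]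
  exact hval (w % 8) (Nat.mod_lt _ (by norm_num))

lemma jacobiSym_eq_neg_one (w : ℕ) {ρ : ℤ} {M : ℕ}
    (hw : ρ = 1 ∧ (w % 4 = 0 ∨ w % 4 = 1) ∨ ρ = -1 ∧ (w % 4 = 2 ∨ w % 4 = 3))
    (hM : (M : ℤ) = 2 * (pellUnit ^ (9 * (2 * w + 1))).re + 1) :
    J(7 * (-2 + 44 * ρ * (pellUnit ^ (9 * (2 * w + 1))).im) | M) = -1 := by
  obtain ⟨c, s, hc0, hc, hs⟩ := exists_nat_pellUnit_pow (9 * w + 4)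
  have hnorm := pellUnit_pow_norm (9 * w + 4)
  have hres := pellUnit_pow_residues w hc hs
  simp only [List.mem_cons, Prod.mk.injEq, List.not_mem_nil, or_false] at hres
  have hsq : pellUnit ^ (9 * (2 * w + 1)) = pellUnit ^ (9 * w + 4) * pellUnit ^ (9 * w + 4)
      * pellUnit := by ring
  rw [hc, hs] at hnorm
  obtain ⟨X, hX⟩ : ∃ X, X = 3 * c + 22 * s := ⟨_, rfl⟩
  obtain ⟨Y, hY⟩ : ∃ Y, Y = 2 * c + 15 * s := ⟨_, rfl⟩
  have hXY : 5 * X ^ 2 = 11 * Y ^ 2 + 1 := by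
    zify
    rw [hX, hY]; push_cast
    linear_combination hnorm
  have hMeq : M = 15 * X ^ 2 + 11 * Y ^ 2 := by
    zify
    rw [hM, hsq, Zsqrtd.re_mul, Zsqrtd.re_mul, Zsqrtd.im_mul, hc, hs, hX, hY]
    simp only [pellUnit]
    push_cast
    linear_combination -hnorm
  have hIm : (pellUnit ^ (9 * (2 * w + 1))).im = 2 * X * Y := by
    rw [hsq, Zsqrtd.im_mul, Zsqrtd.re_mul, Zsqrtd.im_mul, hc, hs, hX, hY]
    simp only [pellUnit]
    push_cast
    ring
  obtain ⟨D, hD⟩ : ∃ D : ℕ, (D : ℤ) = 11 * Y - 5 * ρ * X := by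
    refine ⟨(11 * Y - 5 * ρ * X : ℤ).toNat, Int.toNat_of_nonneg ?_⟩
    rcases hw with ⟨rfl, -⟩ | ⟨rfl, -⟩ <;> omega
  have hρ : ρ ^ 2 = 1 := by rcases hw with ⟨rfl, -⟩ | ⟨rfl, -⟩ <;> rfl
  have hL : J(7 * (-2 + 44 * ρ * (pellUnit ^ (9 * (2 * w + 1))).im) | M)
      = J(7 * (2 * (2 * (2 * (X * (ρ * D))))) | M) := by
    apply jacobiSym.mod_left'
    refine Int.modEq_iff_dvd.2 ⟨-14, ?_⟩
    rw [hIm, hD, hMeq]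
    zify at hXY
    push_cast
    linear_combination (-14 : ℤ) * hXY - 280 * X ^ 2 * hρ
  have hfin : ∀ x y m d : ℕ, X % 616 = x → Y % 56 = y →
      (15 * x ^ 2 + 11 * y ^ 2) % 56 = m → D % 8360 = d →
      x % 2 = 1 → m % 4 = 3 → d % 2 = 1 →
      J(7 | m % 28) * (J(2 | m % 8) * (J(2 | m % 8) * (J(2 | m % 8) * (J(-11 | x % 44) *
        (J(ρ | m % 4) * J(-2090 | d)))))) = -1 →
      J(7 * (2 * (2 * (2 * (X * (ρ * D))))) | M) = -1 := by
    intro x y m d h1 h2 h3 h4 h5 h6 h7 h8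
    replace h3 : M % 56 = m := by
      have hx : X % 56 = x % 56 := by omega
      have hy : Y % 56 = y % 56 := by omega
      rw [hMeq, ← h3]
      exact ((Nat.ModEq.pow 2 hx).mul_left 15).add ((Nat.ModEq.pow 2 hy).mul_left 11)
    have hMo : Odd M := Nat.odd_iff.2 (by omega)
    rw [← h8]
    simp only [jacobiSym.mul_left]
    rw [jacobiSym_left_factor (Nat.odd_iff.2 (by omega)) (by omega) hXY hMeq,
      jacobiSym_right_factor hρ (Nat.odd_iff.2 (by omega)) (by omega) hXY hMeq hD,
      jacobiSym.mod_right 7 hMo, jacobiSym.mod_right 2 hMo, jacobiSym.mod_right ρ hMo]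
    have hρ' : 4 * ρ.natAbs = 4 := by rcases hw with ⟨rfl, -⟩ | ⟨rfl, -⟩ <;> rfl
    rw [hρ', h4]
    norm_num only [Int.natAbs]
    rw [show M % 28 = m % 28 by omega, show M % 8 = m % 8 by omega,
      show M % 4 = m % 4 by omega, show X % 44 = x % 44 by omega]
  rw [hL]
  rcases hres with ⟨h, hcm, hsm⟩ | ⟨h, hcm, hsm⟩ | ⟨h, hcm, hsm⟩ | ⟨h, hcm, hsm⟩ |
      ⟨h, hcm, hsm⟩ | ⟨h, hcm, hsm⟩ | ⟨h, hcm, hsm⟩ | ⟨h, hcm, hsm⟩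
  · obtain rfl : ρ = 1 := by omega
    exact hfin 179 26 11 3087 (by omega) (by omega) rfl (by omega) rfl rfl rfl (by norm_num)
  · obtain rfl : ρ = 1 := by omega
    exact hfin 267 6 19 3923 (by omega) (by omega) rfl (by omega) rfl rfl rfl (by norm_num)
  · obtain rfl : ρ = -1 := by omega
    exact hfin 531 34 19 4437 (by omega) (by omega) rfl (by omega) rfl rfl rfl (by norm_num)
  · obtain rfl : ρ = -1 := by omega
    exact hfin 3 54 11 5273 (by omega) (by omega) rfl (by omega) rfl rfl rfl (by norm_num)
  · obtain rfl : ρ = 1 := by omega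
    exact hfin 3 2 11 3087 (by omega) (by omega) rfl (by omega) rfl rfl rfl (by norm_num)
  · obtain rfl : ρ = 1 := by omega
    exact hfin 531 22 19 3923 (by omega) (by omega) rfl (by omega) rfl rfl rfl (by norm_num)
  · obtain rfl : ρ = -1 := by omega
    exact hfin 267 50 19 4437 (by omega) (by omega) rfl (by omega) rfl rfl rfl (by norm_num)
  · obtain rfl : ρ = -1 := by omega
    exact hfin 179 30 11 5273 (by omega) (by omega) rfl (by omega) rfl rfl rfl (by norm_num)

lemma pellUnit_pow_mul_congr {m j : ℕ} {χ : ℤ} (h : j % 3 = 1 ∧ χ = 1 ∨ j % 3 = 2 ∧ χ = -1) :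
    2 * (pellUnit ^ m).re + 1 ∣ (pellUnit ^ (m * j)).re - (pellUnit ^ m).re ∧
      2 * (pellUnit ^ m).re + 1 ∣ (pellUnit ^ (m * j)).im - χ * (pellUnit ^ m).im := by
  have hnorm := pellUnit_pow_norm m
  rw [pow_mul]
  generalize pellUnit ^ m = E at hnorm ⊢
  have hsq : E ^ 2 + E + 1 = ((2 * E.re + 1 : ℤ) : ℤ√55) * E := by
    rw [pow_two]
    ext
    · simp only [Zsqrtd.re_add, Zsqrtd.re_mul, Zsqrtd.re_one, Zsqrtd.re_intCast, Zsqrtd.im_intCast]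
      linear_combination -hnorm
    · simp only [Zsqrtd.im_add, Zsqrtd.im_mul, Zsqrtd.im_one, Zsqrtd.re_intCast, Zsqrtd.im_intCast]
      ring
  have hcube : ((2 * E.re + 1 : ℤ) : ℤ√55) ∣ E ^ 3 - 1 :=
    Dvd.intro (E * (E - 1)) (by linear_combination (1 - E) * hsq)
  have hd := dvd_pow_add_sub_pow hcube (j / 3) (j % 3)
  rw [Nat.div_add_mod, Zsqrtd.intCast_dvd, Zsqrtd.re_sub, Zsqrtd.im_sub] at hd
  rcases h with ⟨hj, rfl⟩ | ⟨hj, rfl⟩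
  · simpa [hj] using hd
  · rw [hj, pow_two E, Zsqrtd.re_mul, Zsqrtd.im_mul] at hd
    constructor
    · have e : (E ^ j).re - E.re = ((E ^ j).re - (E.re * E.re + 55 * E.im * E.im))
          + (2 * E.re + 1) * (E.re - 1) := by linear_combination -hnorm
      rw [e]
      exact dvd_add hd.1 (dvd_mul_right _ _)
    · have e : (E ^ j).im - -1 * E.im = ((E ^ j).im - (E.re * E.im + E.im * E.re))
          + (2 * E.re + 1) * E.im := by ring
      rw [e]
      exact dvd_add hd.2 (dvd_mul_right _ _)

lemma ne_of_jacobiSym {w j : ℕ} {σ χ u : ℤ} (hχ : j % 3 = 1 ∧ χ = 1 ∨ j % 3 = 2 ∧ χ = -1)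
    (hw : σ * χ = 1 ∧ (w % 4 = 0 ∨ w % 4 = 1) ∨ σ * χ = -1 ∧ (w % 4 = 2 ∨ w % 4 = 3)) :
    7 * u ^ 2 ≠ 2 * (3 * (pellUnit ^ (9 * (2 * w + 1) * j)).re
      + 22 * σ * (pellUnit ^ (9 * (2 * w + 1) * j)).im) + 1 := by
  intro h
  obtain ⟨hd1, hd2⟩ := pellUnit_pow_mul_congr (m := 9 * (2 * w + 1)) hχ
  obtain ⟨c, s, -, hc, -⟩ := exists_nat_pellUnit_pow (9 * (2 * w + 1))
  have hM : ((2 * c + 1 : ℕ) : ℤ) = 2 * (pellUnit ^ (9 * (2 * w + 1))).re + 1 := by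
    rw [hc]; push_cast; ring
  have hJ := jacobiSym_eq_neg_one w hw hM
  have hmod : J(7 * (-2 + 44 * (σ * χ) * (pellUnit ^ (9 * (2 * w + 1))).im) | 2 * c + 1)
      = J(7 * u * (7 * u) | 2 * c + 1) := by
    apply jacobiSym.mod_left'
    refine Int.modEq_iff_dvd.2 ?_
    rw [hM]
    set C := (pellUnit ^ (9 * (2 * w + 1))).re
    set S := (pellUnit ^ (9 * (2 * w + 1))).im
    have e : 7 * u * (7 * u) - 7 * (-2 + 44 * (σ * χ) * S)
        = 42 * ((pellUnit ^ (9 * (2 * w + 1) * j)).re - C)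
          + 308 * σ * ((pellUnit ^ (9 * (2 * w + 1) * j)).im - χ * S) + (2 * C + 1) * 21 := by
      linear_combination 7 * h
    rw [e]
    exact dvd_add (dvd_add (hd1.mul_left _) (hd2.mul_left _)) (dvd_mul_right _ _)
  rw [hJ, jacobiSym.mul_left] at hmod
  have := mul_self_nonneg J(7 * u | 2 * c + 1)
  omega

lemma three_pow_mod_eight (k : ℕ) : 3 ^ k % 8 = 1 ∨ 3 ^ k % 8 = 3 := by
  induction k with
  | zero => simp
  | succ k ih => rw [pow_succ]; omega

lemma ne_of_dvd {n : ℕ} (hn : n ≠ 0) (hdvd : 117 ∣ n) {σ : ℤ} (hσ : σ = 1 ∨ σ = -1) (u : ℤ) :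
    7 * u ^ 2 ≠ 2 * (3 * (pellUnit ^ n).re + 22 * σ * (pellUnit ^ n).im) + 1 := by
  obtain ⟨t, j, hj, rfl⟩ := Nat.exists_eq_pow_mul_and_not_dvd hn 3 (by norm_num)
  have ht : 2 ≤ t := by
    have h9 : 3 ^ 2 ∣ 3 ^ t * j := (by norm_num : 3 ^ 2 ∣ 117).trans hdvd
    have hco : Nat.Coprime (3 ^ 2) j :=
      Nat.Coprime.pow_left _ ((Nat.Prime.coprime_iff_not_dvd Nat.prime_three).2 hj)
    exact (Nat.pow_dvd_pow_iff_le_right (by norm_num)).1 (hco.dvd_of_dvd_mul_right h9)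
  obtain ⟨k, rfl⟩ := Nat.exists_eq_add_of_le ht
  have h13 : 13 ∣ j := by
    have h := (by norm_num : 13 ∣ 117).trans hdvd
    exact (Nat.Coprime.pow_right _ (by norm_num)).dvd_of_dvd_mul_left h
  obtain ⟨i, rfl⟩ := h13
  obtain ⟨χ, hχ⟩ : ∃ χ : ℤ, i % 3 = 1 ∧ χ = 1 ∨ i % 3 = 2 ∧ χ = -1 := by
    rcases (by omega : i % 3 = 1 ∨ i % 3 = 2) with h | h
    · exact ⟨1, .inl ⟨h, rfl⟩⟩
    · exact ⟨-1, .inr ⟨h, rfl⟩⟩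
  have hρ : σ * χ = 1 ∨ σ * χ = -1 := by
    rcases hσ with rfl | rfl <;> rcases hχ with ⟨-, rfl⟩ | ⟨-, rfl⟩ <;> simp
  have h8 := three_pow_mod_eight k
  rcases hρ with hρ | hρ
  · have e : 3 ^ (2 + k) * (13 * i) = 9 * (2 * (3 ^ k / 2) + 1) * (13 * i) := by
      rw [pow_add, show 2 * (3 ^ k / 2) + 1 = 3 ^ k by omega]
      rfl
    rw [e]
    exact ne_of_jacobiSym (χ := χ) (by omega) (.inl ⟨hρ, by omega⟩)
  · have e : 3 ^ (2 + k) * (13 * i) = 9 * (2 * (13 * 3 ^ k / 2) + 1) * i := by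
      rw [pow_add, show 2 * (13 * 3 ^ k / 2) + 1 = 13 * 3 ^ k by omega]
      ring
    rw [e]
    exact ne_of_jacobiSym hχ (.inr ⟨hρ, by omega⟩)

lemma sq_eq_one_of_quartic {u w : ℤ} (h : 11 * w ^ 2 = 245 * u ^ 4 - 70 * u ^ 2 + 1) :
    u ^ 2 = 1 := by
  have hu : u % 2 = 1 := by
    by_contra hu
    obtain ⟨a, rfl⟩ : ∃ a, u = 2 * a := ⟨u / 2, by omega⟩
    have hw : w % 4 = 0 ∨ w % 4 = 1 ∨ w % 4 = 2 ∨ w % 4 = 3 := by omega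
    have h4 : (11 * w ^ 2) % 4 = 1 := by
      rw [h]; ring_nf; omega
    rcases hw with hw | hw | hw | hw <;> simp [Int.mul_emod, pow_two, hw] at h4
  obtain ⟨a, rfl⟩ : ∃ a, u = 2 * a + 1 := ⟨u / 2, by omega⟩
  obtain ⟨x, hx⟩ : ∃ x, 2 * x + 1 = 7 * (2 * a + 1) ^ 2 := ⟨14 * a ^ 2 + 14 * a + 3, by ring⟩
  have hxw : 11 * w ^ 2 = 4 * (5 * x ^ 2 - 1) := by
    have : 11 * w ^ 2 = 5 * (2 * x) ^ 2 - 4 := by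
      rw [show 2 * x = 7 * (2 * a + 1) ^ 2 - 1 by omega, h]; ring
    linarith
  obtain ⟨y, rfl⟩ : ∃ y, w = 2 * y := by
    have h2 : (2 : ℤ) ∣ 11 * w ^ 2 := ⟨2 * (5 * x ^ 2 - 1), by rw [hxw]; ring⟩
    exact Int.prime_two.dvd_of_dvd_pow ((Int.prime_two.dvd_mul.1 h2).resolve_left (by norm_num))
  have hx0 : 0 ≤ x := by nlinarith [sq_nonneg (2 * a + 1)]
  have hpell : 5 * x.natAbs ^ 2 = 11 * y.natAbs ^ 2 + 1 := by
    zify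
    simp only [sq_abs]
    linarith
  obtain ⟨n, hn, -⟩ := exists_eq_pellUnit_pow _ _ hpell
  rw [Int.natAbs_of_nonneg hx0] at hn
  have hn' : 7 * (2 * a + 1) ^ 2 = 2 * (3 * (pellUnit ^ n).re + 22 * (pellUnit ^ n).im) + 1 := by
    rw [← hx, hn]
  rcases exponent_mod hn' with h0 | h0
  · rcases eq_or_ne n 0 with rfl | hne
    · rw [pow_zero] at hn'
      simp only [Zsqrtd.re_one, Zsqrtd.im_one] at hn'
      linarith
    · refine absurd ?_ (ne_of_dvd hne (Nat.dvd_of_mod_eq_zero h0) (.inl rfl) (2 * a + 1))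
      rw [hn']; ring
  · refine absurd ?_ (ne_of_dvd (Nat.succ_ne_zero n) (by omega) (.inr rfl) (2 * a + 1))
    rw [hn', Nat.succ_eq_add_one, pellUnit_pow_succ_re, pellUnit_pow_succ_im]
    ring

/-- A rational number `t` with `11 * t ^ 2` integral is an integer. -/
lemma exists_int_of_eleven_mul_sq {t : ℚ} {B : ℤ} (h : 11 * t ^ 2 = B) : ∃ z : ℤ, t = z := by
  have hint : IsIntegral ℤ (11 * t) := by
    apply IsIntegral.of_pow (n := 2) (by norm_num)
    have : (11 * t) ^ 2 = algebraMap ℤ ℚ (11 * B) := by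
      simp only [algebraMap_int_eq, eq_intCast, Int.cast_mul, ← h]
      push_cast; ring
    rw [this]
    exact isIntegral_algebraMap
  obtain ⟨T, hT⟩ := IsIntegrallyClosed.isIntegral_iff.1 hint
  simp only [algebraMap_int_eq, eq_intCast] at hT
  have hTB : T ^ 2 = 11 * B := by
    have : ((T ^ 2 : ℤ) : ℚ) = ((11 * B : ℤ) : ℚ) := by
      push_cast
      rw [hT, ← h]; ring
    exact_mod_cast this
  have hp : Prime (11 : ℤ) := by
    rw [Int.prime_iff_natAbs_prime]; norm_num
  obtain ⟨z, rfl⟩ := hp.dvd_of_dvd_pow (Dvd.intro _ hTB.symm)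
  refine ⟨z, ?_⟩
  push_cast at hT
  linarith

lemma seven_dvd_of_quartic {a t q : ℤ}
    (h : 11 * t ^ 2 = 5 * a ^ 4 - 70 * a ^ 2 * q ^ 2 + 49 * q ^ 4) : 7 ∣ a ∧ 7 ∣ t := by
  have key : ∀ a t : ZMod 7, 11 * t ^ 2 = 5 * a ^ 4 → a = 0 ∧ t = 0 := by decide
  have h7 := congrArg (Int.cast : ℤ → ZMod 7) h
  push_cast at h7
  rw [show (70 : ZMod 7) = 0 from rfl, show (49 : ZMod 7) = 0 from rfl] at h7
  obtain ⟨ha, ht⟩ := key a t (by rw [h7]; ring)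
  exact ⟨(ZMod.intCast_zmod_eq_zero_iff_dvd _ 7).1 ha, (ZMod.intCast_zmod_eq_zero_iff_dvd _ 7).1 ht⟩

theorem stmt_16 (U V : ℚ) (hU : ∃ k : ℕ, U.den = 7 ^ k) (hV : ∃ k : ℕ, V.den = 7 ^ k)
    (h : 11 * V ^ 2 = 5 * U ^ 4 - 70 * U ^ 2 + 49) :
    (U, V) = (7, 28) ∨ (U, V) = (7, -28) ∨ (U, V) = (-7, 28) ∨ (U, V) = (-7, -28) := by
  obtain ⟨k, hk⟩ := hU
  have hq : (U.den : ℚ) ≠ 0 := by exact_mod_cast U.den_ne_zero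
  have hUq : U * U.den = U.num := Rat.mul_den_eq_num U
  have hB : 11 * (V * U.den ^ 2) ^ 2
      = ((5 * U.num ^ 4 - 70 * U.num ^ 2 * U.den ^ 2 + 49 * U.den ^ 4 : ℤ) : ℚ) := by
    push_cast
    rw [← hUq]
    linear_combination (U.den : ℚ) ^ 4 * h
  obtain ⟨t, ht⟩ := exists_int_of_eleven_mul_sq hB
  rw [ht] at hB
  obtain ⟨⟨u, hu⟩, ⟨w, hw⟩⟩ :=
    seven_dvd_of_quartic (a := U.num) (t := t) (q := U.den) (by exact_mod_cast hB)
  have hden : U.den = 1 := by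
    rcases k.eq_zero_or_pos with rfl | hpos
    · simpa using hk
    · exfalso
      have h1 : 7 ∣ U.num.natAbs := Int.natCast_dvd.1 ⟨u, hu⟩
      have h2 : 7 ∣ U.den := hk ▸ dvd_pow_self 7 hpos.ne'
      exact Nat.not_coprime_of_dvd_of_dvd (by norm_num) h1 h2 U.reduced
  rw [hden, hu] at hUq
  rw [hden, hw] at ht
  push_cast at hUq ht
  have hUu : U = 7 * u := by linarith
  have hVw : V = 7 * w := by linarith
  have hquartic : 11 * w ^ 2 = 245 * u ^ 4 - 70 * u ^ 2 + 1 := by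
    rw [hUu, hVw] at h
    have : (11 * w ^ 2 : ℚ) = 245 * u ^ 4 - 70 * u ^ 2 + 1 := by linarith
    exact_mod_cast this
  have hu1 := sq_eq_one_of_quartic hquartic
  have hw4 : w ^ 2 = 4 ^ 2 := by
    rw [show u ^ 4 = (u ^ 2) ^ 2 by ring, hu1] at hquartic
    linarith
  rcases sq_eq_sq_iff_eq_or_eq_neg.1 (hu1.trans (one_pow 2).symm) with rfl | rfl <;>
    rcases sq_eq_sq_iff_eq_or_eq_neg.1 hw4 with rfl | rfl <;> norm_num [hUu, hVw]
end

section
/- Let U and V be rational numbers whose denominators are powers of 7 (i.e., {7}-integral rationals) satisfying V² = 5·U⁴ − 70·U² + 49. Then U = 0 and V = 7 or V = −7. -/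
theorem Rat.exists_int_eq_of_sq_eq_intCast {q : ℚ} {n : ℤ} (h : q ^ 2 = n) :
    ∃ m : ℤ, q = m := by
  have hden : q.den ^ 2 = 1 := by
    rw [← Rat.den_pow, h, Rat.den_intCast]
  exact ⟨q.num, (Rat.den_eq_one_iff q |>.mp (by simpa using hden)).symm⟩

theorem seven_dvd_of_sq_modEq {a b : ℤ} (h : b ^ 2 ≡ 5 * a ^ 4 [ZMOD 7]) :
    (7 : ℤ) ∣ a ∧ (7 : ℤ) ∣ b := by
  have hz := (ZMod.intCast_eq_intCast_iff _ _ 7).mpr h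
  push_cast at hz
  have key : ∀ x y : ZMod 7, y ^ 2 = 5 * x ^ 4 → x = 0 ∧ y = 0 := by decide
  obtain ⟨ha, hb⟩ := key _ _ hz
  exact ⟨(ZMod.intCast_zmod_eq_zero_iff_dvd a 7).mp ha,
    (ZMod.intCast_zmod_eq_zero_iff_dvd b 7).mp hb⟩

theorem sq_add_five_mul_sq_ne (s t u : ℤ) : s ^ 2 + 5 * t ^ 2 ≠ 35 * u ^ 2 - 1 := by
  intro h
  have hz := congrArg (Int.cast : ℤ → ZMod 8) h
  push_cast at hz
  have key : ∀ x y z : ZMod 8, x ^ 2 + 5 * y ^ 2 ≠ 35 * z ^ 2 - 1 := by decide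
  exact key _ _ _ hz

theorem not_five_dvd_of_mul_eq {p q u : ℤ} (hp : 0 < p) (hq : 0 < q)
    (hmul : p * q = 245 * u ^ 4) (hadd : p + q = 35 * u ^ 2 - 1) : ¬ (5 : ℤ) ∣ q := by
  rintro ⟨r, rfl⟩
  have hr : 0 < r := by lia
  have hprod : p * r = (7 * u ^ 2) ^ 2 := by linarith
  have hcop : IsCoprime p r :=
    ⟨25 * r - 35 * u ^ 2 - 1, -5 * (35 * u ^ 2 + 1), by
      linear_combination (-(35 * u ^ 2) - 1) * hadd + 25 * hprod⟩
  obtain ⟨s, hs | hs⟩ := Int.sq_of_isCoprime hcop hprod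
  · obtain ⟨t, ht | ht⟩ := Int.sq_of_isCoprime hcop.symm ((mul_comm r p).trans hprod)
    · exact sq_add_five_mul_sq_ne s t u (by rw [← hs, ← ht, hadd])
    · nlinarith [sq_nonneg t]
  · nlinarith [sq_nonneg s]

theorem eq_zero_of_sq_eq_quartic {u v : ℤ} (h : v ^ 2 = 245 * u ^ 4 - 70 * u ^ 2 + 1) :
    u = 0 := by
  by_contra hu
  have hu2 : 0 < u ^ 2 := by positivity
  have hu4 : 0 < u ^ 4 := by positivity
  have hpar : (2 : ℤ) ∣ 35 * u ^ 2 - 1 - v := by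
    have hz := congrArg (Int.cast : ℤ → ZMod 2) h
    push_cast at hz
    have key : ∀ x y : ZMod 2, y ^ 2 = 245 * x ^ 4 - 70 * x ^ 2 + 1 →
        35 * x ^ 2 - 1 - y = 0 := by decide
    refine (ZMod.intCast_zmod_eq_zero_iff_dvd _ 2).mp ?_
    push_cast
    exact key _ _ hz
  obtain ⟨p, hp⟩ := hpar
  obtain ⟨q, hq⟩ : ∃ q, q = p + v := ⟨_, rfl⟩
  have hadd : p + q = 35 * u ^ 2 - 1 := by linarith
  have hmul : p * q = 245 * u ^ 4 := by
    have hv : v = 35 * u ^ 2 - 1 - 2 * p := by linarith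
    subst hv
    subst hq
    linarith
  have hp0 : 0 < p := by
    by_contra! hle
    nlinarith
  have hq0 : 0 < q := pos_of_mul_pos_right (by rw [hmul]; positivity) hp0.le
  have h5 : (5 : ℤ) ∣ p * q := ⟨49 * u ^ 4, by rw [hmul]; ring⟩
  rcases (Int.prime_iff_natAbs_prime.mpr (by norm_num)).dvd_or_dvd h5 with hd | hd
  · exact not_five_dvd_of_mul_eq hq0 hp0 (by rw [mul_comm, hmul]) (by rw [add_comm, hadd]) hd
  · exact not_five_dvd_of_mul_eq hp0 hq0 hmul hadd hd

theorem den_eq_one_of_sq_eq_quartic {U V : ℚ} (hU : ∃ k : ℕ, U.den = 7 ^ k)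
    (h : V ^ 2 = 5 * U ^ 4 - 70 * U ^ 2 + 49) : U.den = 1 := by
  obtain ⟨k, hk⟩ := hU
  rcases k with _ | k
  · simpa using hk
  exfalso
  have hd0 : (U.den : ℚ) ≠ 0 := by exact_mod_cast U.den_nz
  have hUd : U * U.den = U.num := Rat.mul_den_eq_num U
  have hW : (V * U.den ^ 2) ^ 2 =
      ((5 * U.num ^ 4 - 70 * U.num ^ 2 * U.den ^ 2 + 49 * U.den ^ 4 : ℤ) : ℚ) := by
    push_cast
    rw [← hUd]
    linear_combination (U.den : ℚ) ^ 4 * h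
  obtain ⟨b, hb⟩ := Rat.exists_int_eq_of_sq_eq_intCast hW
  rw [hb] at hW
  have hW' : b ^ 2 = 5 * U.num ^ 4 - 70 * U.num ^ 2 * U.den ^ 2 + 49 * U.den ^ 4 := by
    exact_mod_cast hW
  have h7 : (7 : ℤ) ∣ U.num := by
    refine (seven_dvd_of_sq_modEq (b := b) (Int.modEq_iff_dvd.mpr
      ⟨10 * U.num ^ 2 * U.den ^ 2 - 7 * U.den ^ 4, ?_⟩)).1
    rw [hW']
    ring
  have h7' : 7 ∣ U.den := hk ▸ dvd_pow_self 7 k.succ_ne_zero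
  have := Nat.dvd_gcd (Int.natCast_dvd.mp h7) h7'
  rw [U.reduced.gcd_eq_one] at this
  norm_num at this

theorem stmt_17 (U V : ℚ) (hU : ∃ k : ℕ, U.den = 7 ^ k) (hV : ∃ k : ℕ, V.den = 7 ^ k)
    (h : V ^ 2 = 5 * U ^ 4 - 70 * U ^ 2 + 49) :
    U = 0 ∧ (V = 7 ∨ V = -7) := by
  have hU0 : U = 0 := by
    obtain ⟨a, rfl⟩ : ∃ a : ℤ, U = a :=
      ⟨U.num, ((Rat.den_eq_one_iff U).mp (den_eq_one_of_sq_eq_quartic hU h)).symm⟩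
    obtain ⟨b, rfl⟩ := Rat.exists_int_eq_of_sq_eq_intCast
      (q := V) (n := 5 * a ^ 4 - 70 * a ^ 2 + 49) (by push_cast; exact h)
    have hab : b ^ 2 = 5 * a ^ 4 - 70 * a ^ 2 + 49 := by exact_mod_cast h
    obtain ⟨⟨u, rfl⟩, ⟨v, rfl⟩⟩ := seven_dvd_of_sq_modEq (a := a) (b := b)
      (Int.modEq_iff_dvd.mpr ⟨10 * a ^ 2 - 7, by rw [hab]; ring⟩)
    have hu : u = 0 := eq_zero_of_sq_eq_quartic (v := v) (by linarith)
    simp [hu]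
  refine ⟨hU0, sq_eq_sq_iff_eq_or_eq_neg.mp ?_⟩
  rw [h, hU0]
  norm_num
end
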